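/- There exists an absolute constant C_h ∈ ℝ_+ such that for all d, W, L ∈ ℕ with W ≥ d and W, L ≥ 2, and for every γ ∈ ℝ_+, the fat-shattering dimension of the class of output-truncated ReLU network realizations satisfies fat(T_1 ∘ R(d,W,L), γ) ≤ C_h · W²L² · log(WL). -/

import Mathlib

open MeasureTheory ProbabilityTheory ENNReal

noncomputable section

/-- A ReLU network configuration with input dimension `d`:
a finite sequence of matrix–vector pairs `(A_i, b_i)`, `i = 0, …, depth − 1`. -/
structure ReLUNet (d : ℕ) where
  depth : ℕ
  depth_pos : 0 < depth
  width : ℕ → ℕ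
  width_in : width 0 = d
  width_out : width depth = 1
  A : ∀ i : ℕ, Matrix (Fin (width (i + 1))) (Fin (width i)) ℝ
  b : ∀ i : ℕ, Fin (width (i + 1)) → ℝ

namespace ReLUNet

variable {d : ℕ}

/-- The affine map `x ↦ A_i x + b_i` of layer `i`. -/
def layer (Φ : ReLUNet d) (i : ℕ) (x : Fin (Φ.width i) → ℝ) :
    Fin (Φ.width (i + 1)) → ℝ :=
  fun j => (∑ k, Φ.A i j k * x k) + Φ.b i j

/-- Output after the first `i` affine layers, with the ReLU activation `ρ(x) = max{x,0}`
applied between consecutive affine layers (not on the input and not after the last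
affine layer). -/
def forward (Φ : ReLUNet d) : (i : ℕ) → (Fin (Φ.width 0) → ℝ) → Fin (Φ.width i) → ℝ
  | 0, x => x
  | i + 1, x =>
      Φ.layer i fun k => if i = 0 then Φ.forward i x k else max (Φ.forward i x k) 0

/-- The realization `R(Φ) : ℝ^d → ℝ` of a network configuration. -/
def realization (Φ : ReLUNet d) (x : Fin d → ℝ) : ℝ :=
  Φ.forward Φ.depth (fun k => x (Fin.cast Φ.width_in k)) (Fin.cast Φ.width_out.symm 0)

/-- All layer widths are at most `W`. -/
def widthLe (Φ : ReLUNet d) (W : ℕ) : Prop :=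
  ∀ i ≤ Φ.depth, Φ.width i ≤ W

/-- All weights have absolute value at most `B`. -/
def magLe (Φ : ReLUNet d) (B : ℝ) : Prop :=
  ∀ i < Φ.depth, (∀ j k, |Φ.A i j k| ≤ B) ∧ ∀ j, |Φ.b i j| ≤ B

/-- All weights take values in the set `𝔸`. -/
def coefIn (Φ : ReLUNet d) (𝔸 : Set ℝ) : Prop :=
  ∀ i < Φ.depth, (∀ j k, Φ.A i j k ∈ 𝔸) ∧ ∀ j, Φ.b i j ∈ 𝔸

open Classical in
/-- The connectivity (total number of nonzero weights) of a network configuration. -/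
def connectivity (Φ : ReLUNet d) : ℕ :=
  ∑ i ∈ Finset.range Φ.depth,
    ((Finset.univ.filter fun jk : Fin (Φ.width (i + 1)) × Fin (Φ.width i) =>
        Φ.A i jk.1 jk.2 ≠ 0).card
      + (Finset.univ.filter fun j : Fin (Φ.width (i + 1)) => Φ.b i j ≠ 0).card)

end ReLUNet

/-- `R(d,W,L,B)`: realizations of ReLU networks with input dimension `d`, output
dimension 1, width at most `W`, depth at most `L`, and weight magnitude at most `B`. -/
def RclassB (d W L : ℕ) (B : ℝ) : Set ((Fin d → ℝ) → ℝ) :=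
  {f | ∃ Φ : ReLUNet d, Φ.widthLe W ∧ Φ.depth ≤ L ∧ Φ.magLe B ∧ Φ.realization = f}

/-- `R(d,W,L)`: realizations with width at most `W` and depth at most `L`,
with no constraint on the weight magnitude. -/
def Rclass (d W L : ℕ) : Set ((Fin d → ℝ) → ℝ) :=
  {f | ∃ Φ : ReLUNet d, Φ.widthLe W ∧ Φ.depth ≤ L ∧ Φ.realization = f}

/-- `R_𝔸(d,W,L)`: realizations with width at most `W`, depth at most `L`, and all
weights taking values in `𝔸`. -/
def RclassCoef (d W L : ℕ) (𝔸 : Set ℝ) : Set ((Fin d → ℝ) → ℝ) :=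
  {f | ∃ Φ : ReLUNet d, Φ.widthLe W ∧ Φ.depth ≤ L ∧ Φ.coefIn 𝔸 ∧ Φ.realization = f}

/-- `R(d,W,L,B,s)`: realizations with width ≤ `W`, depth ≤ `L`, weight magnitude ≤ `B`,
and connectivity ≤ `s`. -/
def RclassSparse (d W L : ℕ) (B : ℝ) (s : ℕ) : Set ((Fin d → ℝ) → ℝ) :=
  {f | ∃ Φ : ReLUNet d, Φ.widthLe W ∧ Φ.depth ≤ L ∧ Φ.magLe B ∧
    Φ.connectivity ≤ s ∧ Φ.realization = f}

/-- The unit cube `[0,1]^d`. -/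
def unitCube (d : ℕ) : Set (Fin d → ℝ) := Set.univ.pi fun _ => Set.Icc (0 : ℝ) 1

/-- The `L^p([0,1]^d)` distance between two functions on `ℝ^d` (with `p = ⊤`
corresponding to `L^∞`). -/
def cubeDist (d : ℕ) (p : ℝ≥0∞) (f g : (Fin d → ℝ) → ℝ) : ℝ≥0∞ :=
  eLpNorm (f - g) p (volume.restrict (unitCube d))

/-- The `L^p([0,1])` distance between two functions on `ℝ`. -/
def intervalDist (p : ℝ≥0∞) (f g : ℝ → ℝ) : ℝ≥0∞ :=
  eLpNorm (f - g) p (volume.restrict (Set.Icc (0 : ℝ) 1))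

/-- The `ε`-covering number of `X` with respect to the extended distance `δ`:
the cardinality of a smallest subset `C ⊆ X` such that every point of `X` is within
distance `ε` of some point of `C` (equal to `⊤` if no finite covering exists). -/
def coveringNumber {α : Type*} (ε : ℝ≥0∞) (X : Set α) (δ : α → α → ℝ≥0∞) : ℕ∞ :=
  sInf {n : ℕ∞ | ∃ C : Finset α, ↑C ⊆ X ∧ (∀ x ∈ X, ∃ c ∈ C, δ x c ≤ ε) ∧ (C.card : ℕ∞) = n}

/-- The `ε`-packing number of `X` with respect to the extended distance `δ`:
the cardinality of a largest subset of `X` whose points have pairwise distances `> ε`. -/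
def packingNumber {α : Type*} (ε : ℝ≥0∞) (X : Set α) (δ : α → α → ℝ≥0∞) : ℕ∞ :=
  sSup {n : ℕ∞ | ∃ C : Finset α, ↑C ⊆ X ∧
    (∀ x ∈ C, ∀ y ∈ C, x ≠ y → ε < δ x y) ∧ (C.card : ℕ∞) = n}

/-- Base-2 logarithm of an extended natural number, valued in `ℝ≥0∞`. -/
def elog2 (n : ℕ∞) : ℝ≥0∞ :=
  if n = ⊤ then ⊤ else ENNReal.ofReal (Real.logb 2 (n.toNat : ℝ))

/-- The minimax approximation error `A(G, F, δ) = sup_{g ∈ G} inf_{f ∈ F} δ(f, g)`. -/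
def minimaxErr {α : Type*} (G F : Set α) (δ : α → α → ℝ≥0∞) : ℝ≥0∞ :=
  ⨆ g ∈ G, ⨅ f ∈ F, δ f g

/-- The truncation operator `T_E(x) = max{−E, min{E, x}}`. -/
def trunc (E x : ℝ) : ℝ := max (-E) (min E x)

/-- `T_E ∘ F = {T_E ∘ f : f ∈ F}`. -/
def truncClass {α : Type*} (E : ℝ) (F : Set (α → ℝ)) : Set (α → ℝ) :=
  (fun f => trunc E ∘ f) '' F

/-- The `L²(P)` distance between two functions. -/
def L2dist {α : Type*} [MeasurableSpace α] (P : MeasureTheory.Measure α) (f g : α → ℝ) :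
    ℝ≥0∞ :=
  MeasureTheory.eLpNorm (f - g) 2 P

/-- A class `F` of real-valued functions on `α` `γ`-fat-shatters `m` points if there are
points `x_1,…,x_m` and levels `y_1,…,y_m` such that for every sign pattern
`b ∈ {0,1}^m` some `f ∈ F` satisfies `f(x_i) ≥ y_i + γ` when `b_i = 1` and
`f(x_i) ≤ y_i` when `b_i = 0`. The fat-shattering dimension `fat(F,γ)` is the largest
such `m`. -/
def fatShatters {α : Type*} (F : Set (α → ℝ)) (γ : ℝ) (m : ℕ) : Prop :=
  ∃ (x : Fin m → α) (y : Fin m → ℝ), ∀ b : Fin m → Bool, ∃ f ∈ F, ∀ i,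
    (b i = true → y i + γ ≤ f (x i)) ∧ (b i = false → f (x i) ≤ y i)

namespace MvPolynomial

variable {σ : Type*}

lemma totalDegree_pderiv_le {R : Type*} [CommSemiring R] (i : σ) (p : MvPolynomial σ R) :
    (pderiv i p).totalDegree ≤ p.totalDegree := by
  conv_lhs => rw [p.as_sum, map_sum]
  refine totalDegree_finsetSum_le fun e he => ?_
  rw [pderiv_monomial]
  refine (totalDegree_monomial_le _ _).trans (le_trans ?_ (le_totalDegree he))
  exact Finsupp.degree_mono tsub_le_self

/-- The partial derivative of the evaluation map is the evaluation of `pderiv`. -/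
lemma hasDerivAt_eval_update [DecidableEq σ] (i : σ) (x : σ → ℝ) (p : MvPolynomial σ ℝ) :
    HasDerivAt (fun t => eval (Function.update x i t) p) (eval x (pderiv i p)) (x i) := by
  induction p using MvPolynomial.induction_on with
  | C a => simpa using hasDerivAt_const (x i) a
  | add p q hp hq => simpa only [map_add] using hp.fun_add hq
  | mul_X p j hp =>
    have hX : HasDerivAt (fun t => Function.update x i t j) (eval x (pderiv i (X j))) (x i) := by
      rcases eq_or_ne j i with rfl | h
      · simpa using hasDerivAt_id' (x j)
      · simpa [h, pderiv_X_of_ne h] using hasDerivAt_const (x i) (x j)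
    have hmul := hp.fun_mul hX
    simp only [Function.update_eq_self] at hmul
    simpa only [pderiv_mul, map_add, map_mul, eval_X] using hmul

lemma eval_pderiv_eq_zero_of_isLocalMax {x : σ → ℝ} {p : MvPolynomial σ ℝ}
    (h : IsLocalMax (fun y => eval y p) x) (i : σ) : eval x (pderiv i p) = 0 := by
  classical
  have hc : Filter.Tendsto (Function.update x i) (nhds (x i)) (nhds x) := by
    have : Continuous (Function.update x i) := continuous_const.update i continuous_id
    simpa using this.tendsto (x i)
  have : IsLocalMax (fun t => eval (Function.update x i t) p) (x i) := by
    have h' := hc.eventually h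
    simpa [IsLocalMax, IsMaxFilter] using h'
  exact this.hasDerivAt_eq_zero (hasDerivAt_eval_update i x p)

lemma abs_eval_le [Fintype σ] (p : MvPolynomial σ ℝ) (x : σ → ℝ) :
    |eval x p| ≤ (∑ e ∈ p.support, |coeff e p|) * (1 + ‖x‖) ^ p.totalDegree := by
  rw [eval_eq', Finset.sum_mul]
  refine (Finset.abs_sum_le_sum_abs _ _).trans (Finset.sum_le_sum fun e he => ?_)
  rw [abs_mul, Finset.abs_prod]
  gcongr
  calc ∏ i, |x i ^ e i| ≤ ∏ i, (1 + ‖x‖) ^ e i := by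
        refine Finset.prod_le_prod (fun i _ => abs_nonneg _) fun i _ => ?_
        rw [abs_pow]
        have := norm_le_pi_norm x i
        rw [Real.norm_eq_abs] at this
        gcongr
        linarith
    _ = (1 + ‖x‖) ^ ∑ i, e i := Finset.prod_pow_eq_pow_sum _ _ _
    _ ≤ (1 + ‖x‖) ^ p.totalDegree := by
        refine pow_le_pow_right₀ (by simp) ?_
        rw [← Finsupp.degree_eq_sum]
        exact le_totalDegree he

/-- On a finite set of points, the indicator of a single point is given by a polynomial. -/
lemma exists_eval_eq_single (Z : Finset (σ → ℝ)) (z₀ : Z) [DecidableEq Z] :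
    ∃ p : MvPolynomial σ ℝ, (fun z : Z => eval z.1 p) = Pi.single z₀ 1 := by
  have hsep : ∀ z : Z, z ≠ z₀ → ∃ q : MvPolynomial σ ℝ, eval z.1 q = 0 ∧ eval z₀.1 q = 1 := by
    intro z hz
    obtain ⟨i, hi⟩ := Function.ne_iff.1 (Subtype.coe_ne_coe.2 hz)
    exact ⟨C ((z₀.1 i - z.1 i)⁻¹) * (X i - C (z.1 i)), by simp,
      by simpa using inv_mul_cancel₀ (sub_ne_zero.2 hi.symm)⟩
  choose! q hq₀ hq₁ using hsep
  refine ⟨∏ z ∈ Finset.univ.erase z₀, q z, ?_⟩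
  funext w
  rw [map_prod]
  rcases eq_or_ne w z₀ with rfl | hw
  · rw [Pi.single_eq_same]
    exact Finset.prod_eq_one fun z hz => hq₁ z (Finset.ne_of_mem_erase hz)
  · rw [Pi.single_eq_of_ne hw]
    exact Finset.prod_eq_zero (Finset.mem_erase.2 ⟨hw, Finset.mem_univ w⟩) (hq₀ w hw)

/-- A system of equations `x i ^ Δ = r i x` with `r i` of total degree less than `Δ`
has at most `Δ ^ |σ|` solutions. -/
lemma card_le_pow_of_pow_eq_eval [Fintype σ] {Δ : ℕ} (r : σ → MvPolynomial σ ℝ)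
    (hr : ∀ i, (r i).totalDegree < Δ) (Z : Finset (σ → ℝ))
    (hZ : ∀ z ∈ Z, ∀ i, z i ^ Δ = eval z (r i)) : Z.card ≤ Δ ^ Fintype.card σ := by
  classical
  let b : (σ → Fin Δ) → (Z → ℝ) := fun e z => ∏ i, z.1 i ^ (e i : ℕ)
  let V : Submodule ℝ (Z → ℝ) := Submodule.span ℝ (Set.range b)
  have hV : ∀ (n : ℕ) (p : MvPolynomial σ ℝ), p.totalDegree < n →
      (fun z : Z => eval z.1 p) ∈ V := by
    intro n
    induction n with
    | zero => simp
    | succ n ih =>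
      intro p hp
      have hsum : (fun z : Z => eval z.1 p)
          = ∑ e ∈ p.support, coeff e p • fun z : Z => ∏ i, z.1 i ^ e i := by
        ext z
        simp [eval_eq']
      rw [hsum]
      refine V.sum_mem fun e he => V.smul_mem _ ?_
      by_cases hlt : ∀ i, e i < Δ
      · exact Submodule.subset_span ⟨fun i => ⟨e i, hlt i⟩, rfl⟩
      · push Not at hlt
        obtain ⟨i, hi⟩ := hlt
        have hle : Finsupp.single i Δ ≤ e := by simpa using hi
        have hadd : e - Finsupp.single i Δ + Finsupp.single i Δ = e := tsub_add_cancel_of_le hle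
        have heq : (fun z : Z => ∏ j, z.1 j ^ e j)
            = fun z : Z => eval z.1 (monomial (e - Finsupp.single i Δ) 1 * r i) := by
          ext z
          rw [map_mul, ← hZ z.1 z.2 i]
          conv_lhs => rw [← hadd]
          simp only [Finsupp.add_apply, pow_add, Finset.prod_mul_distrib]
          congr 1
          · simp [eval_monomial, Finsupp.prod_fintype]
          · rw [Finset.prod_eq_single i] <;> simp +contextual [eq_comm]
        rw [heq]
        refine ih _ ?_
        have hdeg : (e - Finsupp.single i Δ).degree + Δ = e.degree := by
          conv_rhs => rw [← hadd, map_add]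
          simp
        have h1 := totalDegree_mul (monomial (e - Finsupp.single i Δ) (1 : ℝ)) (r i)
        have h2 := totalDegree_monomial_le (e - Finsupp.single i Δ) (1 : ℝ)
        have h3 := hr i
        have h4 : e.degree ≤ p.totalDegree := le_totalDegree he
        change _ ≤ (e - Finsupp.single i Δ).degree at h2
        omega
  have htop : V = ⊤ := by
    rw [eq_top_iff]
    intro f _
    rw [pi_eq_sum_univ' f]
    refine V.sum_mem fun z _ => V.smul_mem _ ?_
    obtain ⟨p, hp⟩ := exists_eval_eq_single Z z
    convert hV _ p (Nat.lt_succ_self _) using 1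
    rw [hp]
  have := finrank_range_le_card (R := ℝ) b
  rw [Set.finrank, show Submodule.span ℝ (Set.range b) = ⊤ from htop, finrank_top] at this
  simpa using this


/-- Subtracting a dominating even power makes a polynomial negative far away from the origin. -/
lemma eventually_eval_sub_neg [Fintype σ] (p : MvPolynomial σ ℝ) {n : ℕ}
    (hp : p.totalDegree ≤ 2 * n) {ε : ℝ} (hε : 0 < ε) :
    ∀ᶠ x in Filter.cocompact (σ → ℝ), eval x p - ε * ∑ i, x i ^ (2 * n + 2) ≤ 0 := by
  set c := ∑ e ∈ p.support, |coeff e p| with hc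
  have hc0 : 0 ≤ c := Finset.sum_nonneg fun _ _ => abs_nonneg _
  filter_upwards [(tendsto_norm_cocompact_atTop (E := σ → ℝ)).eventually_ge_atTop
    (max 1 (c * 4 ^ n / ε))] with x hx
  have h1 : 1 ≤ ‖x‖ := (le_max_left _ _).trans hx
  have h2 : c * 4 ^ n ≤ ‖x‖ * ε := (div_le_iff₀ hε).1 ((le_max_right _ _).trans hx)
  have hne : Nonempty σ := by
    by_contra h
    rw [not_nonempty_iff] at h
    rw [Subsingleton.elim x 0, norm_zero] at h1
    linarith
  obtain ⟨i, hi⟩ : ∃ i, ‖x i‖ = ‖x‖ := by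
    obtain ⟨i, -, hi⟩ := Finset.exists_mem_eq_sup' Finset.univ_nonempty fun i => ‖x i‖
    refine ⟨i, le_antisymm (norm_le_pi_norm x i) ?_⟩
    refine (pi_norm_le_iff_of_nonneg (norm_nonneg _)).2 fun j => ?_
    rw [← hi]
    exact Finset.le_sup' (fun i => ‖x i‖) (Finset.mem_univ j)
  have hpow : ‖x‖ ^ (2 * n + 2) ≤ ∑ i, x i ^ (2 * n + 2) := by
    have hev : Even (2 * n + 2) := ⟨n + 1, by ring⟩
    rw [← hi, Real.norm_eq_abs, hev.pow_abs]
    exact Finset.single_le_sum (f := fun i => x i ^ (2 * n + 2))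
      (fun j _ => hev.pow_nonneg _) (Finset.mem_univ i)
  have hle : eval x p ≤ ε * ‖x‖ ^ (2 * n + 2) :=
    calc eval x p ≤ c * (1 + ‖x‖) ^ p.totalDegree := (le_abs_self _).trans (abs_eval_le p x)
      _ ≤ c * (2 * ‖x‖) ^ (2 * n) := by
        gcongr
        exact (pow_le_pow_right₀ (by linarith) hp).trans (by gcongr; linarith)
      _ = c * 4 ^ n * ‖x‖ ^ (2 * n) := by rw [mul_pow, pow_mul 2]; norm_num; ring
      _ ≤ ‖x‖ * ε * ‖x‖ ^ (2 * n) := by gcongr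
      _ ≤ ‖x‖ * ε * ‖x‖ ^ (2 * n) * ‖x‖ := le_mul_of_one_le_right (by positivity) h1
      _ = ε * ‖x‖ ^ (2 * n + 2) := by ring
  have := mul_le_mul_of_nonneg_left hpow hε.le
  linarith

/-- **Warren's bound** in a weak form: the number of sign patterns that finitely many
polynomials attain. -/
lemma card_image_sign_le {ι : Type*} [Fintype ι] [Fintype σ] [DecidableEq (ι → Bool)]
    (p : ι → MvPolynomial σ ℝ) {D : ℕ}
    (hp : ∀ i, (p i).totalDegree ≤ D) (T : Finset (σ → ℝ)) :
    (T.image fun x i => decide (0 < eval x (p i))).card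
      ≤ (2 * (Fintype.card ι * D) + 1) ^ Fintype.card σ := by
  classical
  set n := Fintype.card ι * D with hn
  obtain ⟨δ, hδ, hδ0⟩ : ∃ δ : ℝ, (∀ x ∈ T, ∀ i, 0 < eval x (p i) → δ < eval x (p i)) ∧ 0 < δ := by
    have h : ∀ᶠ δ in nhdsWithin (0 : ℝ) (Set.Ioi 0),
        ∀ x ∈ T, ∀ i, 0 < eval x (p i) → δ < eval x (p i) := by
      rw [Filter.eventually_all_finset]
      intro x _
      rw [Filter.eventually_all]
      intro i
      by_cases hpos : 0 < eval x (p i)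
      · filter_upwards [nhdsWithin_le_nhds (eventually_lt_nhds hpos)] with _ h _ using h
      · exact Filter.Eventually.of_forall fun _ h => absurd h hpos
    exact (h.and self_mem_nhdsWithin).exists
  let q : ι → MvPolynomial σ ℝ := fun i => p i - C δ
  have hq : ∀ x i, eval x (q i) = eval x (p i) - δ := fun x i => by simp [q]
  let s : (σ → ℝ) → ι → Bool := fun x i => decide (0 < eval x (p i))
  let U : (ι → Bool) → Set (σ → ℝ) := fun a =>
    {x | ∀ i, if a i then 0 < eval x (q i) else eval x (q i) < 0}
  let K : (ι → Bool) → Set (σ → ℝ) := fun a =>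
    {x | ∀ i, if a i then 0 ≤ eval x (q i) else eval x (q i) ≤ 0}
  have hTU : ∀ x ∈ T, x ∈ U (s x) := by
    intro x hx i
    by_cases hpos : 0 < eval x (p i)
    · simpa [s, hpos, hq] using hδ x hx i hpos
    · simp only [s, hpos, hq, decide_false, Bool.false_eq_true, if_false]
      linarith
  have hUK : ∀ a, U a ⊆ K a := by
    intro a x hx i
    have := hx i
    cases h : a i <;> simp only [h, Bool.false_eq_true, if_true, if_false] at this ⊢ <;>
      exact this.le
  have hUopen : ∀ a, IsOpen (U a) := by
    intro a
    simp only [U, Set.ofPred_forall]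
    refine isOpen_iInter_of_finite fun i => ?_
    cases a i
    · simpa using isOpen_lt (continuous_eval (q i)) continuous_const
    · simpa using isOpen_lt continuous_const (continuous_eval (q i))
  have hKclosed : ∀ a, IsClosed (K a) := by
    intro a
    simp only [K, Set.ofPred_forall]
    refine isClosed_iInter fun i => ?_
    cases a i
    · simpa using isClosed_le (continuous_eval (q i)) continuous_const
    · simpa using isClosed_le continuous_const (continuous_eval (q i))
  have hUsign : ∀ a, ∀ x ∈ U a, (fun i => decide (0 < eval x (q i))) = a := by
    intro a x hx
    funext i
    have := hx i
    cases h : a i <;> simp only [h, Bool.false_eq_true, if_true, if_false] at this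
    · simpa using this.le
    · simpa using this
  let g : MvPolynomial σ ℝ := ∏ i, q i
  have hgdeg : (g ^ 2).totalDegree ≤ 2 * n := by
    refine (totalDegree_pow _ _).trans (Nat.mul_le_mul_left _ ?_)
    refine (totalDegree_finsetProd _ _).trans ?_
    refine (Finset.sum_le_card_nsmul _ _ D fun i _ => ?_).trans (by simp [hn])
    exact (totalDegree_sub_C_le _ _).trans (hp i)
  have hKU : ∀ a x, x ∈ K a → eval x g ≠ 0 → x ∈ U a := by
    intro a x hx hg i
    have h0 : eval x (q i) ≠ 0 := by
      rw [map_prod] at hg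
      exact Finset.prod_ne_zero_iff.1 hg i (Finset.mem_univ i)
    have := hx i
    cases h : a i <;> simp only [h, Bool.false_eq_true, if_true, if_false] at this ⊢
    · exact lt_of_le_of_ne this h0
    · exact lt_of_le_of_ne this h0.symm
  have hgT : ∀ x ∈ T, 0 < eval x g ^ 2 := by
    intro x hx
    refine sq_pos_of_ne_zero ?_
    rw [map_prod]
    refine Finset.prod_ne_zero_iff.2 fun i _ => ?_
    have := hTU x hx i
    split_ifs at this
    · exact this.ne'
    · exact this.ne
  obtain ⟨ε, hεT, hε⟩ : ∃ ε : ℝ,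
      (∀ x ∈ T, 0 < eval x g ^ 2 - ε * ∑ i, x i ^ (2 * n + 2)) ∧ 0 < ε := by
    have h : ∀ᶠ ε in nhdsWithin (0 : ℝ) (Set.Ioi 0),
        ∀ x ∈ T, 0 < eval x g ^ 2 - ε * ∑ i, x i ^ (2 * n + 2) := by
      rw [Filter.eventually_all_finset]
      intro x hx
      refine nhdsWithin_le_nhds ?_
      have hc : Continuous fun ε : ℝ => eval x g ^ 2 - ε * ∑ i, x i ^ (2 * n + 2) := by fun_prop
      exact hc.continuousAt.eventually_const_lt (by simpa using hgT x hx)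
    exact (h.and self_mem_nhdsWithin).exists
  let h : MvPolynomial σ ℝ := g ^ 2 - C ε * ∑ i, X i ^ (2 * n + 2)
  have heval : ∀ x, eval x h = eval x g ^ 2 - ε * ∑ i, x i ^ (2 * n + 2) := fun x => by simp [h]
  have hcrit : ∀ x ∈ T, ∃ z ∈ U (s x), ∀ i, eval z (pderiv i h) = 0 := by
    intro x hx
    obtain ⟨z, hzK, hz⟩ := (continuous_eval h).continuousOn.exists_isMaxOn' (hKclosed (s x))
      (hUK _ (hTU x hx)) (by
        refine Filter.Eventually.filter_mono inf_le_left ?_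
        filter_upwards [eventually_eval_sub_neg (g ^ 2) hgdeg hε] with y hy
        rw [map_pow, ← heval] at hy
        exact hy.trans (by rw [heval]; exact (hεT x hx).le))
    have hzx : eval x h ≤ eval z h := hz (hUK _ (hTU x hx))
    have hzg : eval z g ≠ 0 := by
      intro h0
      have h1 := hεT x hx
      rw [← heval] at h1
      rw [heval z, h0] at hzx
      have h2 : 0 ≤ ∑ i, z i ^ (2 * n + 2) :=
        Finset.sum_nonneg fun i _ => Even.pow_nonneg ⟨n + 1, by ring⟩ _
      have := mul_nonneg hε.le h2
      linarith
    have hzU := hKU _ z hzK hzg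
    exact ⟨z, hzU, eval_pderiv_eq_zero_of_isLocalMax
      (hz.isLocalMax (Filter.mem_of_superset ((hUopen _).mem_nhds hzU) (hUK _)))⟩
  choose! ζ hζU hζ using hcrit
  have hcard : (T.image s).card ≤ (T.image ζ).card := by
    refine Finset.card_le_card_of_surjOn (fun z i => decide (0 < eval z (q i))) ?_
    rw [Finset.coe_image, Finset.coe_image]
    rintro _ ⟨x, hx, rfl⟩
    exact ⟨ζ x, Set.mem_image_of_mem _ hx, hUsign _ _ (hζU x hx)⟩
  refine hcard.trans (card_le_pow_of_pow_eq_eval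
    (fun i => C (ε * (2 * n + 2))⁻¹ * pderiv i (g ^ 2)) (fun i => ?_) _ ?_)
  · refine Nat.lt_succ_of_le ((totalDegree_mul _ _).trans ?_)
    rw [totalDegree_C, zero_add]
    exact (totalDegree_pderiv_le _ _).trans hgdeg
  · intro z hz i
    obtain ⟨x, hx, rfl⟩ := Finset.mem_image.1 hz
    have hd : pderiv i h = pderiv i (g ^ 2) - C (ε * (2 * n + 2)) * X i ^ (2 * n + 1) := by
      have : pderiv i (∑ j, (X j : MvPolynomial σ ℝ) ^ (2 * n + 2))
          = C (2 * n + 2 : ℝ) * (X i : MvPolynomial σ ℝ) ^ (2 * n + 1) := by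
        rw [map_sum, Finset.sum_eq_single i]
        · rw [pderiv_pow, pderiv_X_self]
          simp [show (C 2 : MvPolynomial σ ℝ) = 2 from map_ofNat C 2]
        · intro j _ hj
          rw [pderiv_pow, pderiv_X_of_ne hj, mul_zero]
        · simp
      rw [map_sub, pderiv_C_mul, this, ← mul_assoc, ← C_mul]
    have h0 := hζ x hx i
    rw [hd] at h0
    simp only [map_sub, map_mul, eval_C, map_pow, eval_X] at h0 ⊢
    have : ε * (2 * n + 2) ≠ 0 := by positivity
    rw [eq_comm, inv_mul_eq_iff_eq_mul₀ this]
    linarith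

/-- The sign patterns of polynomials `p h k i` which may depend on the signs `h` that were
recorded in the earlier rounds: round `k` is recorded at index `k`. -/
def signHistory {ι : Type*} (p : (ℕ → ι → Bool) → ℕ → ι → MvPolynomial σ ℝ) :
    ℕ → (σ → ℝ) → ℕ → ι → Bool
  | 0, _ => fun _ _ => false
  | k + 1, x => Function.update (signHistory p k x) k
      fun i => decide (0 < eval x (p (signHistory p k x) k i))

lemma signHistory_apply {ι : Type*} (p : (ℕ → ι → Bool) → ℕ → ι → MvPolynomial σ ℝ)
    (x : σ → ℝ) {i k : ℕ} (hik : i < k) :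
    signHistory p k x i = fun a => decide (0 < eval x (p (signHistory p i x) i a)) := by
  induction k with
  | zero => omega
  | succ k ih =>
    rw [signHistory]
    rcases Nat.lt_succ_iff_lt_or_eq.1 hik with h | rfl
    · rw [Function.update_of_ne h.ne, ih h]
    · rw [Function.update_self]

lemma card_image_signHistory_le {ι : Type*} [Fintype ι] [Fintype σ]
    [DecidableEq (ℕ → ι → Bool)] (p : (ℕ → ι → Bool) → ℕ → ι → MvPolynomial σ ℝ) {D n : ℕ}
    (hp : ∀ h, ∀ k < n, ∀ i, (p h k i).totalDegree ≤ D) (T : Finset (σ → ℝ)) :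
    (T.image (signHistory p n)).card
      ≤ ((2 * (Fintype.card ι * D) + 1) ^ Fintype.card σ) ^ n := by
  classical
  induction n with
  | zero =>
    rw [pow_zero]
    refine Finset.card_le_one.2 fun a ha b hb => ?_
    obtain ⟨_, -, rfl⟩ := Finset.mem_image.1 ha
    obtain ⟨_, -, rfl⟩ := Finset.mem_image.1 hb
    rfl
  | succ n ih =>
    have hsub : T.image (signHistory p (n + 1)) ⊆ (T.image (signHistory p n)).biUnion fun h =>
        (T.image fun x i => decide (0 < eval x (p h n i))).image (Function.update h n) := by
      intro a ha
      obtain ⟨x, hx, rfl⟩ := Finset.mem_image.1 ha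
      exact Finset.mem_biUnion.2 ⟨_, Finset.mem_image_of_mem _ hx,
        Finset.mem_image_of_mem _ (Finset.mem_image_of_mem _ hx)⟩
    refine (Finset.card_le_card hsub).trans ?_
    refine (Finset.card_biUnion_le_card_mul _ _ _ fun h _ => Finset.card_image_le.trans
      (card_image_sign_le (p h n) (hp h n n.lt_succ_self) T)).trans ?_
    rw [pow_succ]
    exact Nat.mul_le_mul_right _ (ih fun h k hk => hp h k (hk.trans n.lt_succ_self))

end MvPolynomial

/-- Extension of a vector by zeros (or its restriction) to index type `Fin W`. -/
def zeroPad {n : ℕ} (W : ℕ) (f : Fin n → ℝ) (w : Fin W) : ℝ :=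
  if h : (w : ℕ) < n then f ⟨w, h⟩ else 0

namespace ReLUNet

open MvPolynomial

variable {d : ℕ}

/-- The weights of a network, padded by zeros to width `W` in every layer; the index `none`
stands for the bias. -/
def params (Φ : ReLUNet d) (W L : ℕ) : Fin L × Fin W × Option (Fin W) → ℝ
  | (i, w, some v) => zeroPad W (fun j => zeroPad W (Φ.A i j) v) w
  | (i, w, none) => zeroPad W (Φ.b i) w

/-- The output of coordinate `w` of layer `i` at the sample point `x j`, as a polynomial in the
weights, when the active neurons are the ones prescribed by `h`. -/
def layerPoly {m : ℕ} (W L : ℕ) [NeZero L] (x : Fin m → Fin d → ℝ)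
    (h : ℕ → Fin m × Fin W × Bool → Bool) (j : Fin m) :
    ℕ → Fin W → MvPolynomial (Fin L × Fin W × Option (Fin W)) ℝ
  | 0, w => C (zeroPad W (x j) w)
  | i + 1, w => ∑ v, X (Fin.ofNat L i, w, some v) *
      (if i = 0 ∨ h i (j, v, false) = true then layerPoly W L x h j i v else 0)
        + X (Fin.ofNat L i, w, none)

/-- The polynomials whose signs are recorded at layer `i`: the neuron outputs themselves and
their differences to the thresholds `y`. -/
def thresholdPoly {m : ℕ} (W L : ℕ) [NeZero L] (x : Fin m → Fin d → ℝ) (y : Fin m → ℝ)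
    (h : ℕ → Fin m × Fin W × Bool → Bool) (i : ℕ) (a : Fin m × Fin W × Bool) :
    MvPolynomial (Fin L × Fin W × Option (Fin W)) ℝ :=
  layerPoly W L x h a.1 i a.2.1 - C (if a.2.2 then y a.1 else 0)

section

variable {m W L : ℕ} [NeZero L] (x : Fin m → Fin d → ℝ) (y : Fin m → ℝ)

lemma totalDegree_layerPoly_le (h : ℕ → Fin m × Fin W × Bool → Bool) (j : Fin m) (i : ℕ)
    (w : Fin W) : (layerPoly W L x h j i w).totalDegree ≤ i := by
  induction i generalizing w with
  | zero => simp [layerPoly]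
  | succ i ih =>
    rw [layerPoly]
    refine (totalDegree_add _ _).trans (max_le (totalDegree_finsetSum_le fun v _ => ?_) ?_)
    · refine (totalDegree_mul _ _).trans ?_
      rw [totalDegree_X, add_comm]
      refine Nat.add_le_add_right ?_ 1
      split_ifs
      · exact ih v
      · simp
    · rw [totalDegree_X]
      omega

lemma totalDegree_thresholdPoly_le (h : ℕ → Fin m × Fin W × Bool → Bool) (i : ℕ)
    (a : Fin m × Fin W × Bool) : (thresholdPoly W L x y h i a).totalDegree ≤ i :=
  (totalDegree_sub_C_le _ _).trans (totalDegree_layerPoly_le x h _ _ _)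

lemma eval_layerPoly (Φ : ReLUNet d) (hW : Φ.widthLe W) (hL : Φ.depth ≤ L) (j : Fin m)
    {i k : ℕ} (hi : i ≤ Φ.depth) (hik : i ≤ k) (w : Fin W) :
    eval (Φ.params W L)
        (layerPoly W L x (signHistory (thresholdPoly W L x y) k (Φ.params W L)) j i w)
      = zeroPad W (Φ.forward i fun k => x j (Fin.cast Φ.width_in k)) w := by
  induction i generalizing k w with
  | zero => simp [layerPoly, forward, zeroPad, Φ.width_in]
  | succ i ih =>
    have hact : ∀ v, signHistory (thresholdPoly W L x y) k (Φ.params W L) i (j, v, false)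
        = decide (0 < zeroPad W (Φ.forward i fun k => x j (Fin.cast Φ.width_in k)) v) := by
      intro v
      rw [signHistory_apply _ _ (Nat.lt_of_succ_le hik)]
      simp [thresholdPoly, ih (by omega) le_rfl]
    have hiL : ((Fin.ofNat L i : Fin L) : ℕ) = i := Nat.mod_eq_of_lt (by omega)
    have hterm : ∀ v, eval (Φ.params W L)
        (if i = 0 ∨ signHistory (thresholdPoly W L x y) k (Φ.params W L) i (j, v, false) = true
          then layerPoly W L x (signHistory (thresholdPoly W L x y) k (Φ.params W L)) j i v
          else 0)
        = zeroPad W (fun k => if i = 0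
            then Φ.forward i (fun k => x j (Fin.cast Φ.width_in k)) k
            else max (Φ.forward i (fun k => x j (Fin.cast Φ.width_in k)) k) 0) v := by
      intro v
      have h1 := ih (k := k) (by omega) (by omega) v
      rw [hact v, apply_ite (eval (Φ.params W L)), h1, map_zero]
      by_cases hi0 : i = 0
      · simp [hi0]
      · simp only [hi0, false_or, decide_eq_true_eq, if_false]
        unfold zeroPad
        split_ifs with h2 h3 h4
        · exact (max_eq_left h3.le).symm
        · exact (max_eq_right (not_lt.1 h3)).symm
        · rfl
        · rfl
    rw [layerPoly, map_add, map_sum]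
    simp only [map_mul, eval_X, hterm]
    have hp1 : ∀ v, Φ.params W L (Fin.ofNat L i, w, some v)
        = zeroPad W (fun j => zeroPad W (Φ.A i j) v) w := by
      intro v
      rw [params, hiL]
    have hp2 : Φ.params W L (Fin.ofNat L i, w, none) = zeroPad W (Φ.b i) w := by
      rw [params, hiL]
    simp only [hp1, hp2, forward]
    by_cases hw : (w : ℕ) < Φ.width (i + 1)
    · simp only [zeroPad, hw, dif_pos, layer]
      congr 1
      refine (Fintype.sum_of_injective (Fin.castLE (hW i (by omega)))
        (Fin.castLE_injective _) _ _ (fun v hv => ?_) fun v => ?_).symm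
      · have : ¬ (v : ℕ) < Φ.width i := fun h => hv ⟨⟨v, h⟩, rfl⟩
        simp [this]
      · simp
    · simp [zeroPad, hw]

end

end ReLUNet

lemma lt_of_lt_trunc {E y z : ℝ} (hy : -E ≤ y) (h : y < trunc E z) : y < z := by
  rcases lt_max_iff.1 h with h | h
  · exact absurd h (not_lt.2 hy)
  · exact (lt_min_iff.1 h).2

lemma le_of_trunc_le {E y z : ℝ} (hy : y < E) (h : trunc E z ≤ y) : z ≤ y := by
  rcases min_le_iff.1 ((le_max_right _ _).trans h) with h | h
  · exact absurd h (not_le.2 hy)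
  · exact h

/-- Fat-shattering at scale `γ > 0` by truncated networks forces exponentially many activation
patterns. -/
lemma two_pow_le_of_fatShatters {d W L m : ℕ} {γ : ℝ} (hW : 0 < W) (hL : 0 < L) (hγ : 0 < γ)
    (hm : fatShatters (truncClass 1 (Rclass d W L)) γ m) :
    2 ^ m ≤ (L + 1) *
      ((2 * (m * (W * 2) * L) + 1) ^ (L * (W * (W + 1)))) ^ (L + 1) := by
  classical
  have : NeZero L := ⟨hL.ne'⟩
  obtain ⟨x, y, hxy⟩ := hm
  have hnet : ∀ b : Fin m → Bool, ∃ Φ : ReLUNet d, Φ.widthLe W ∧ Φ.depth ≤ L ∧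
      ∀ i, (b i = true → y i + γ ≤ trunc 1 (Φ.realization (x i))) ∧
        (b i = false → trunc 1 (Φ.realization (x i)) ≤ y i) := by
    intro b
    obtain ⟨_, ⟨_, ⟨Φ, h1, h2, rfl⟩, rfl⟩, h3⟩ := hxy b
    exact ⟨Φ, h1, h2, h3⟩
  choose Φ hΦW hΦL hΦ using hnet
  have hy1 : ∀ i, -1 ≤ y i := fun i =>
    (le_max_left _ _).trans ((hΦ (fun _ => false) i).2 rfl)
  have hy2 : ∀ i, y i < 1 := fun i => by
    have h1 := (hΦ (fun _ => true) i).1 rfl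
    have h2 : trunc 1 ((Φ fun _ => true).realization (x i)) ≤ 1 :=
      max_le (by norm_num) (min_le_left _ _)
    linarith
  have hsign : ∀ b i, decide (0 < (Φ b).realization (x i) - y i) = b i := by
    intro b i
    cases hb : b i
    · simpa using le_of_trunc_le (hy2 i) ((hΦ b i).2 hb)
    · simpa using lt_of_lt_trunc (hy1 i) (by linarith [(hΦ b i).1 hb])
  let H := MvPolynomial.signHistory (ReLUNet.thresholdPoly W L x y) (L + 1)
  have hrec : ∀ b i, H ((Φ b).params W L) (Φ b).depth (i, ⟨0, hW⟩, true) = b i := by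
    intro b i
    rw [← hsign b i]
    simp only [H]
    rw [MvPolynomial.signHistory_apply _ _ (Nat.lt_succ_of_le (hΦL b))]
    simp only [ReLUNet.thresholdPoly, map_sub, MvPolynomial.eval_C, if_true]
    rw [ReLUNet.eval_layerPoly x y (Φ b) (hΦW b) (hΦL b) i le_rfl le_rfl]
    have h1 : 0 < (Φ b).width (Φ b).depth := by simp [(Φ b).width_out]
    simp only [zeroPad, h1, dif_pos, ReLUNet.realization]
    congr 4
  let T : Finset (Fin L × Fin W × Option (Fin W) → ℝ) :=
    Finset.univ.image fun b => (Φ b).params W L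
  have hinj : (Finset.univ : Finset (Fin m → Bool)).card
      ≤ (Finset.range (L + 1) ×ˢ T.image H).card := by
    refine Finset.card_le_card_of_injOn (fun b => ((Φ b).depth, H ((Φ b).params W L)))
      (fun b _ => ?_) fun b _ b' _ h => ?_
    · exact Finset.mem_product.2 ⟨Finset.mem_range.2 (Nat.lt_succ_of_le (hΦL b)),
        Finset.mem_image_of_mem _ (Finset.mem_image_of_mem _ (Finset.mem_univ b))⟩
    · obtain ⟨h1, h2⟩ := Prod.mk.inj h
      funext i
      rw [← hrec b i, ← hrec b' i, h1, h2]
  have hT := MvPolynomial.card_image_signHistory_le (ReLUNet.thresholdPoly W L x y)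
    (D := L) (n := L + 1)
    (fun h k hk a => (ReLUNet.totalDegree_thresholdPoly_le x y h k a).trans (by omega)) T
  rw [Finset.card_product, Finset.card_range] at hinj
  simp only [Finset.card_univ, Fintype.card_pi, Fintype.card_bool, Finset.prod_const,
    Fintype.card_fin, Fintype.card_prod, Fintype.card_option] at hinj hT
  exact hinj.trans (Nat.mul_le_mul_left _ hT)

lemma le_mul_logb_of_two_pow_le {m W L : ℕ} (hW : 2 ≤ W) (hL : 2 ≤ L)
    (h : 2 ^ m ≤ (L + 1) *
      ((2 * (m * (W * 2) * L) + 1) ^ (L * (W * (W + 1)))) ^ (L + 1)) :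
    (m : ℝ) ≤ 100 * ((W : ℝ) ^ 2 * (L : ℝ) ^ 2) * Real.logb 2 ((W : ℝ) * (L : ℝ)) := by
  obtain ⟨q, hq⟩ : ∃ q, q = W * L := ⟨_, rfl⟩
  have hq4 : 4 ≤ q := by nlinarith
  have hqR : (4 : ℝ) ≤ q := by exact_mod_cast hq4
  have hlogq : 2 * Real.log 2 ≤ Real.log q := by
    have := Real.log_le_log (by norm_num) hqR
    rwa [show (4 : ℝ) = 2 ^ 2 by norm_num, Real.log_pow] at this
  have hlog2 := Real.log_two_gt_d9
  have hlog2' := Real.log_two_lt_d9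
  have hlogb : Real.log q ≤ Real.logb 2 q := by
    rw [Real.logb, le_div_iff₀ (by linarith)]
    nlinarith
  rw [← mul_pow, show (W : ℝ) * L = q by rw [hq]; push_cast; ring]
  rcases Nat.eq_zero_or_pos m with rfl | hm
  · have : 0 ≤ Real.logb 2 q := by linarith
    simp only [Nat.cast_zero]
    positivity
  have hmR : (1 : ℝ) ≤ m := by exact_mod_cast hm
  have hmq : q ≤ m * q := Nat.le_mul_of_pos_left q hm
  have hbound : 2 ^ m ≤ (5 * (m * q)) ^ (5 * q ^ 2) := by
    refine h.trans ?_
    rw [← pow_mul]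
    have h1 : L + 1 ≤ 5 * (m * q) := by nlinarith
    have h2 : 2 * (m * (W * 2) * L) + 1 ≤ 5 * (m * q) := by
      have : 2 * (m * (W * 2) * L) = 4 * (m * q) := by rw [hq]; ring
      omega
    have h3 : L * (W * (W + 1)) * (L + 1) ≤ 4 * q ^ 2 := by
      calc L * (W * (W + 1)) * (L + 1) ≤ L * (W * (2 * W)) * (2 * L) := by gcongr <;> omega
        _ = 4 * q ^ 2 := by rw [hq]; ring
    calc _ ≤ 5 * (m * q) * (5 * (m * q)) ^ (4 * q ^ 2) :=
          Nat.mul_le_mul h1 ((Nat.pow_le_pow_left h2 _).trans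
            (Nat.pow_le_pow_right (by omega) h3))
      _ = (5 * (m * q)) ^ (4 * q ^ 2 + 1) := (pow_succ' _ _).symm
      _ ≤ _ := Nat.pow_le_pow_right (by omega) (by nlinarith)
  have hlog : m * Real.log 2 ≤ 5 * q ^ 2 * Real.log (5 * (m * q)) := by
    have := Real.log_le_log (by positivity) (Nat.cast_le (α := ℝ).2 hbound)
    push_cast [Real.log_pow] at this
    exact this
  set t : ℝ := m / q ^ 2 with ht
  have hq2 : (0 : ℝ) < (q : ℝ) ^ 2 := by positivity
  have htpos : 0 < t := by positivity
  have hmt : (m : ℝ) = t * q ^ 2 := by rw [ht]; field_simp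
  have hsplit : Real.log (5 * (m * q)) = Real.log 80 + 3 * Real.log q + Real.log (t / 16) := by
    rw [show (5 : ℝ) * (m * q) = 80 * q ^ 3 * (t / 16) by rw [hmt]; ring,
      Real.log_mul (by positivity) (by positivity), Real.log_mul (by positivity) (by positivity),
      Real.log_pow]
    norm_num
  have h80 : Real.log 80 ≤ 7 * Real.log 2 := by
    have := Real.log_le_log (by norm_num) (show (80 : ℝ) ≤ 2 ^ 7 by norm_num)
    rwa [Real.log_pow] at this
  have htlog : Real.log (t / 16) ≤ t / 16 - 1 := Real.log_le_sub_one_of_pos (by positivity)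
  have hineq : t * Real.log 2 ≤ 5 * Real.log (5 * (m * q)) := by
    have : t * Real.log 2 * q ^ 2 ≤ 5 * Real.log (5 * (m * q)) * q ^ 2 := by
      calc t * Real.log 2 * q ^ 2 = m * Real.log 2 := by rw [hmt]; ring
        _ ≤ _ := hlog
        _ = _ := by ring
    exact le_of_mul_le_mul_right this hq2
  have htle : t ≤ 100 * Real.logb 2 q := by
    have h0 : t * 0.69 ≤ t * Real.log 2 := by gcongr; linarith
    rw [hsplit] at hineq
    linarith
  calc (m : ℝ) = t * q ^ 2 := hmt
    _ ≤ 100 * Real.logb 2 q * q ^ 2 := by gcongr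
    _ = _ := by ring

/-- Fat-shattering dimension upper bound for output-truncated ReLU
networks: `fat(T₁ ∘ R(d,W,L), γ) ≤ C_h · W²L² · log(WL)` for every `γ > 0`. -/
theorem fat_shattering_upper_bound_truncated_networks :
    ∃ Ch : ℝ, 0 < Ch ∧
      ∀ (d W L : ℕ) (γ : ℝ), 0 < d → d ≤ W → 2 ≤ W → 2 ≤ L → 0 < γ →
        ∀ m : ℕ, fatShatters (truncClass 1 (Rclass d W L)) γ m →
          (m : ℝ) ≤ Ch * ((W : ℝ) ^ 2 * (L : ℝ) ^ 2) * Real.logb 2 ((W : ℝ) * (L : ℝ)) := by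
  exact ⟨100, by norm_num, fun d W L γ _ _ hW hL hγ m hm =>
    le_mul_logb_of_two_pow_le hW hL (two_pow_le_of_fatShatters (by omega) (by omega) hγ hm)⟩
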